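/- Let d ≥ 1, n ≥ 1 an integer, β, μ ∈ (0,1], θ₁ ≥ 0, and θ₃, θ₄ ≥ 0 with θ₃ − θ₄ ≤ 1. Then there is a constant N = N(d, θ₁, θ₃, θ₄, n, β) such that for every n-times continuously differentiable φ: ℝ^d → ℝ with |r₁^{−θ₁}φ|_{n+β} < ∞ and every n-times continuously differentiable H: ℝ^d → ℝ^d with N₂ := |r₁^{−θ₃}H|₀ + |r₁^{−θ₄}∇H|_{n−1+μ} < ∞, one has: (i) sup_x r₁(x)^{−θ₁θ₃}|φ(H(x))| ≤ |r₁^{−θ₁}φ|₀ (1 + |r₁^{−θ₃}H|₀)^{θ₁}; and (ii) |r₁^{−θ₁θ₃−θ₄(n+μ∧β)} ∇(φ∘H)|_{n−1+μ∧β} ≤ N |r₁^{−θ₁}φ|_{n+β} (1 + N₂)^{θ₁+(μ∧β)+n}, where μ∧β = min(μ,β). -/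

import Mathlib

open scoped ENNReal RealInnerProductSpace

noncomputable section

/-- `ℝ^d` with the Euclidean norm. -/
abbrev Euc (d : ℕ) : Type := EuclideanSpace ℝ (Fin d)

/-- The weight `r₁(x) = (1 + |x|²)^{1/2}`. -/
def r1 {d : ℕ} (x : Euc d) : ℝ := Real.sqrt (1 + ‖x‖ ^ 2)

/-- Sup-norm `|f|₀ = sup_x ‖f x‖`, valued in `[0,∞]`. -/
def nrm0 {d : ℕ} {V : Type*} [NormedAddCommGroup V] (f : Euc d → V) : ℝ≥0∞ :=
  ⨆ x, (‖f x‖₊ : ℝ≥0∞)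

/-- Hölder seminorm `[f]_β = sup_{x ≠ y} ‖f x - f y‖ / ‖x - y‖^β`, valued in `[0,∞]`. -/
def hsemi {d : ℕ} {V : Type*} [NormedAddCommGroup V] (β : ℝ) (f : Euc d → V) : ℝ≥0∞ :=
  ⨆ (x : Euc d) (y : Euc d) (_ : x ≠ y),
    (‖f x - f y‖₊ : ℝ≥0∞) / ENNReal.ofReal (‖x - y‖ ^ β)

/-- Partial derivative in the `i`-th coordinate direction. -/
def pder {d : ℕ} {V : Type*} [NormedAddCommGroup V] [NormedSpace ℝ V]
    (i : Fin d) (f : Euc d → V) : Euc d → V :=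
  fun x => fderiv ℝ f x (EuclideanSpace.single i 1)

/-- Iterated partial derivative in the `i`-th coordinate direction. -/
def pderPow {d : ℕ} {V : Type*} [NormedAddCommGroup V] [NormedSpace ℝ V]
    (i : Fin d) : ℕ → (Euc d → V) → Euc d → V
  | 0, f => f
  | n + 1, f => pder i (pderPow i n f)

/-- Multi-index partial derivative `∂^γ f = ∂_1^{γ 1} ⋯ ∂_d^{γ d} f`. -/
def mder {d : ℕ} {V : Type*} [NormedAddCommGroup V] [NormedSpace ℝ V]
    (γ : Fin d → ℕ) (f : Euc d → V) : Euc d → V :=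
  (List.finRange d).foldr (fun i g => pderPow i (γ i) g) f

/-- `[β]⁻`: for `β > 0`, the nonnegative integer with `β = [β]⁻ + {β}⁺`, `{β}⁺ ∈ (0,1]`. -/
def ifl (β : ℝ) : ℕ := ⌈β⌉₊ - 1

/-- `{β}⁺`: the fractional part in `(0,1]` of `β > 0`. -/
def frc (β : ℝ) : ℝ := β - (ifl β : ℝ)

/-- Hölder norm `|f|_β = Σ_{|γ| ≤ [β]⁻} |∂^γ f|₀ + Σ_{|γ| = [β]⁻} [∂^γ f]_{{β}⁺}`,
valued in `[0,∞]`. -/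
def holNorm {d : ℕ} {V : Type*} [NormedAddCommGroup V] [NormedSpace ℝ V]
    (β : ℝ) (f : Euc d → V) : ℝ≥0∞ :=
  (∑' γ : {γ : Fin d → ℕ // (∑ i, γ i) ≤ ifl β}, nrm0 (mder γ.1 f))
    + ∑' γ : {γ : Fin d → ℕ // (∑ i, γ i) = ifl β}, hsemi (frc β) (mder γ.1 f)

/-- `H̃(x) = x + H(x)`. -/
def tilde {d : ℕ} (H : Euc d → Euc d) : Euc d → Euc d := fun x => x + H x

/-- `H̃⁻¹`, the inverse map of `H̃`. -/
def tildeInv {d : ℕ} (H : Euc d → Euc d) : Euc d → Euc d := Function.invFun (tilde H)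

/-- `F(x) = H̃⁻¹(x) - x`, so that `H̃⁻¹(x) = x + F(x)`. -/
def Fof {d : ℕ} (H : Euc d → Euc d) : Euc d → Euc d := fun x => tildeInv H x - x

section Weight

variable {d : ℕ}

lemma one_le_r1 (x : Euc d) : 1 ≤ r1 x := by
  rw [r1, Real.one_le_sqrt]
  nlinarith [sq_nonneg ‖x‖]

lemma r1_pos (x : Euc d) : 0 < r1 x := lt_of_lt_of_le one_pos (one_le_r1 x)

lemma r1_sq (x : Euc d) : r1 x ^ 2 = 1 + ‖x‖ ^ 2 := Real.sq_sqrt (by positivity)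

lemma norm_le_r1 (x : Euc d) : ‖x‖ ≤ r1 x :=
  Real.le_sqrt_of_sq_le (by linarith)

lemma r1_rpow_pos (x : Euc d) (a : ℝ) : 0 < r1 x ^ a := Real.rpow_pos_of_pos (r1_pos x) a

lemma r1_le_two_mul {x y : Euc d} (h : ‖x - y‖ ≤ 1) : r1 x ≤ 2 * r1 y := by
  have hx : ‖x‖ ≤ ‖y‖ + 1 := by
    have := norm_sub_norm_le x y
    linarith
  refine le_of_sq_le_sq ?_ (by linarith [r1_pos y])
  rw [mul_pow, r1_sq, r1_sq]
  nlinarith [norm_nonneg x, norm_nonneg y, sq_nonneg (‖y‖ - 1)]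

lemma r1_rpow_le {x y : Euc d} (h : ‖x - y‖ ≤ 1) {a R : ℝ} (ha : |a| ≤ R) :
    r1 y ^ a ≤ 2 ^ R * r1 x ^ a := by
  have hxy := r1_le_two_mul h
  have hyx := r1_le_two_mul (x := y) (y := x) (by rwa [norm_sub_rev])
  have hx := r1_pos x
  have hy := r1_pos y
  have key : r1 y ^ a ≤ 2 ^ |a| * r1 x ^ a := by
    rcases le_total 0 a with h0 | h0
    · rw [abs_of_nonneg h0, ← Real.mul_rpow (by norm_num) hx.le]
      exact Real.rpow_le_rpow hy.le hyx h0
    · rw [abs_of_nonpos h0, Real.rpow_neg (by norm_num), ← div_eq_inv_mul,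
        le_div_iff₀ (by positivity), mul_comm, ← Real.mul_rpow (by norm_num) hy.le]
      exact Real.rpow_le_rpow_of_nonpos hx hxy h0
  refine key.trans ?_
  gcongr
  norm_num

lemma r1_rpow_eq (x : Euc d) (a : ℝ) : r1 x ^ a = (1 + ‖x‖ ^ 2) ^ (a / 2) := by
  rw [r1, Real.sqrt_eq_rpow, ← Real.rpow_mul (by positivity)]
  ring_nf

lemma contDiff_r1_rpow (a : ℝ) {n : WithTop ℕ∞} : ContDiff ℝ n (fun x : Euc d => r1 x ^ a) := by
  simp only [r1_rpow_eq]
  exact (contDiff_const.add (contDiff_norm_sq ℝ)).rpow_const_of_ne fun x => by positivity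

end Weight

section PartialDerivatives

variable {d : ℕ} {V V' : Type*} [NormedAddCommGroup V] [NormedSpace ℝ V]
  [NormedAddCommGroup V'] [NormedSpace ℝ V']

lemma pder_r1_rpow (a : ℝ) (i : Fin d) :
    pder i (fun x : Euc d => r1 x ^ a) = fun x => a • (x i • r1 x ^ (a - 2)) := by
  funext x
  have h1 : HasFDerivAt (fun x : Euc d => 1 + ‖x‖ ^ 2) (2 • innerSL ℝ x) x :=
    (hasStrictFDerivAt_norm_sq x).hasFDerivAt.const_add 1
  have h2 := h1.rpow_const (p := a / 2) (Or.inl (by positivity))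
  simp only [pder, r1_rpow_eq]
  rw [h2.fderiv, show (a - 2) / 2 = a / 2 - 1 by ring]
  simp [EuclideanSpace.inner_single_right]
  ring

lemma eq_sum_single (v : Euc d) :
    v = ∑ i, v i • (EuclideanSpace.single i (1 : ℝ) : Euc d) := by
  ext j
  simp [Finset.sum_apply, Pi.single_apply]

lemma norm_clm_le_sum (T : Euc d →L[ℝ] V) :
    ‖T‖ ≤ ∑ i, ‖T (EuclideanSpace.single i 1)‖ := by
  refine T.opNorm_le_bound (Finset.sum_nonneg fun i _ => norm_nonneg _) fun v => ?_
  conv_lhs => rw [eq_sum_single v]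
  rw [map_sum, Finset.sum_mul]
  refine (norm_sum_le _ _).trans (Finset.sum_le_sum fun i _ => ?_)
  rw [map_smul, norm_smul, mul_comm]
  gcongr
  exact PiLp.norm_apply_le v i

lemma pder_comp_clm (L : V →L[ℝ] V') {f : Euc d → V} (hf : Differentiable ℝ f) (i : Fin d) :
    pder i (fun x => L (f x)) = fun x => L (pder i f x) := by
  funext x
  simp only [pder]
  change fderiv ℝ (L ∘ f) x _ = _
  rw [((L.hasFDerivAt).comp x (hf x).hasFDerivAt).fderiv]
  rfl

lemma pder_add {f g : Euc d → V} (hf : Differentiable ℝ f) (hg : Differentiable ℝ g) (i : Fin d) :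
    pder i (fun x => f x + g x) = fun x => pder i f x + pder i g x := by
  funext x
  simp only [pder]
  change fderiv ℝ (f + g) x _ = _
  rw [((hf x).hasFDerivAt.add (hg x).hasFDerivAt).fderiv]
  rfl

lemma pder_smul {f : Euc d → ℝ} {g : Euc d → V} (hf : Differentiable ℝ f)
    (hg : Differentiable ℝ g) (i : Fin d) :
    pder i (fun x => f x • g x) = fun x => pder i f x • g x + f x • pder i g x := by
  funext x
  simp only [pder]
  change fderiv ℝ (f • g) x _ = _
  rw [((hf x).hasFDerivAt.smul (hg x).hasFDerivAt).fderiv]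
  simp [add_comm]

lemma pder_comp {φ : Euc d → ℝ} {H : Euc d → Euc d} (hφ : Differentiable ℝ φ)
    (hH : Differentiable ℝ H) (i : Fin d) :
    pder i (fun x => φ (H x)) = fun x => ∑ j, pder i H x j • pder j φ (H x) := by
  funext x
  simp only [pder]
  change fderiv ℝ (φ ∘ H) x _ = _
  rw [((hφ (H x)).hasFDerivAt.comp x (hH x).hasFDerivAt).fderiv]
  set v := fderiv ℝ H x (EuclideanSpace.single i 1)
  change fderiv ℝ φ (H x) v = _
  conv_lhs => rw [eq_sum_single v]
  simp [map_sum]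

lemma contDiff_pder {f : Euc d → V} {m : ℕ} (hf : ContDiff ℝ (m + 1 : ℕ) f) (i : Fin d) :
    ContDiff ℝ (m : ℕ) (pder i f) := by
  unfold pder
  have := hf.fderiv_right (m := (m : ℕ)) (by norm_cast)
  exact this.clm_apply contDiff_const

lemma pder_comm {f : Euc d → V} (hf : ContDiff ℝ 2 f) (i j : Fin d) :
    pder i (pder j f) = pder j (pder i f) := by
  funext x
  have hd : DifferentiableAt ℝ (fderiv ℝ f) x :=
    (hf.fderiv_right (m := 1) (by norm_num)).differentiable one_ne_zero x
  have key (k l : Fin d) : pder k (pder l f) x =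
      fderiv ℝ (fderiv ℝ f) x (EuclideanSpace.single k 1) (EuclideanSpace.single l 1) := by
    change fderiv ℝ (fun y => fderiv ℝ f y (EuclideanSpace.single l 1)) x _ = _
    rw [fderiv_clm_apply hd (by fun_prop)]
    simp
  rw [key, key]
  exact (hf.contDiffAt.isSymmSndFDerivAt (by simp)) _ _

lemma contDiff_pderPow (i : Fin d) (k : ℕ) : ∀ {m : ℕ} {f : Euc d → V},
    ContDiff ℝ (m + k : ℕ) f → ContDiff ℝ (m : ℕ) (pderPow i k f) := by
  induction k with
  | zero => intro m f hf; exact hf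
  | succ k ih =>
    intro m f hf
    exact contDiff_pder (ih (by rwa [add_assoc, add_comm 1 k])) i

lemma pder_pderPow_comm (i j : Fin d) (k : ℕ) {f : Euc d → V} (hf : ContDiff ℝ (k + 1 : ℕ) f) :
    pder i (pderPow j k f) = pderPow j k (pder i f) := by
  induction k with
  | zero => rfl
  | succ k ih =>
    change pder i (pder j (pderPow j k f)) = pder j (pderPow j k (pder i f))
    rw [← ih (hf.of_le (by norm_cast; omega)), pder_comm]
    exact contDiff_pderPow j k (m := 2) (hf.of_le (by norm_cast; omega))

/-- Iterated partial derivatives along the coordinates in a list. -/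
def listDer (γ : Fin d → ℕ) (l : List (Fin d)) (f : Euc d → V) : Euc d → V :=
  l.foldr (fun i g => pderPow i (γ i) g) f

lemma contDiff_listDer (γ : Fin d → ℕ) (l : List (Fin d)) : ∀ {m : ℕ} {f : Euc d → V},
    ContDiff ℝ (m + (l.map γ).sum : ℕ) f → ContDiff ℝ (m : ℕ) (listDer γ l f) := by
  induction l with
  | nil => intro m f hf; simpa [listDer] using hf
  | cons a l ih =>
    intro m f hf
    refine contDiff_pderPow a (γ a) (ih ?_)
    simpa [add_assoc] using hf

lemma listDer_congr {γ γ' : Fin d → ℕ} {l : List (Fin d)} (h : ∀ i ∈ l, γ i = γ' i)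
    (f : Euc d → V) : listDer γ l f = listDer γ' l f := by
  induction l with
  | nil => rfl
  | cons a l ih =>
    change pderPow a (γ a) (listDer γ l f) = pderPow a (γ' a) (listDer γ' l f)
    rw [ih fun i hi => h i (List.mem_cons_of_mem _ hi), h a List.mem_cons_self]

lemma pder_listDer (γ : Fin d → ℕ) (i : Fin d) {l : List (Fin d)} (hl : l.Nodup) (hi : i ∈ l)
    {f : Euc d → V} (hf : ContDiff ℝ ((l.map γ).sum + 1 : ℕ) f) :
    pder i (listDer γ l f) = listDer (γ + Pi.single i 1) l f := by
  induction l with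
  | nil => simp at hi
  | cons a l ih =>
    change pder i (pderPow a (γ a) (listDer γ l f)) =
      pderPow a ((γ + Pi.single i 1 : Fin d → ℕ) a) (listDer (γ + Pi.single i 1) l f)
    rw [List.map_cons, List.sum_cons] at hf
    have hnd := List.nodup_cons.1 hl
    by_cases hia : i = a
    · subst hia
      have : listDer (γ + Pi.single i 1) l f = listDer γ l f := by
        refine listDer_congr (fun j hj => ?_) f
        have : j ≠ i := fun h => hnd.1 (h ▸ hj)
        simp [this]
      rw [this]
      simp [pderPow]
    · have hil : i ∈ l := (List.mem_cons.1 hi).resolve_left hia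
      rw [pder_pderPow_comm, ih hnd.2 hil (hf.of_le (by norm_cast; omega))]
      · simp [Ne.symm hia]
      · refine contDiff_listDer γ l (hf.of_le ?_)
        norm_cast
        omega

lemma sum_map_finRange (γ : Fin d → ℕ) : ((List.finRange d).map γ).sum = ∑ i, γ i := by
  rw [← List.ofFn_eq_map, List.sum_ofFn]

lemma contDiff_mder (γ : Fin d → ℕ) {m : ℕ} {f : Euc d → V}
    (hf : ContDiff ℝ (m + ∑ i, γ i : ℕ) f) : ContDiff ℝ (m : ℕ) (mder γ f) :=
  contDiff_listDer γ _ (by rwa [sum_map_finRange])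

lemma pder_mder (γ : Fin d → ℕ) (i : Fin d) {f : Euc d → V}
    (hf : ContDiff ℝ ((∑ i, γ i) + 1 : ℕ) f) :
    pder i (mder γ f) = mder (γ + Pi.single i 1) f :=
  pder_listDer γ i (List.nodup_finRange d) (List.mem_finRange i) (by rwa [sum_map_finRange])

lemma mder_zero (f : Euc d → V) : mder 0 f = f := by
  unfold mder
  induction List.finRange d with
  | nil => rfl
  | cons a l ih => rw [List.foldr_cons, ih]; rfl

end PartialDerivatives

section WeightedHolder

variable {d : ℕ} {V V' : Type*} [NormedAddCommGroup V] [NormedSpace ℝ V]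
  [NormedAddCommGroup V'] [NormedSpace ℝ V']

/-- `f` is `m` times differentiable, its partial derivatives of order at most `m` are bounded by
`C r₁^a`, and those of order `m` are locally `δ`-Hölder with constant `C r₁^a`. -/
def WHol (δ a C : ℝ) : ℕ → (Euc d → V) → Prop
  | 0, f => (∀ x, ‖f x‖ ≤ C * r1 x ^ a) ∧
      ∀ x y, ‖x - y‖ ≤ 1 → ‖f x - f y‖ ≤ C * r1 x ^ a * ‖x - y‖ ^ δ
  | m + 1, f => (∀ x, ‖f x‖ ≤ C * r1 x ^ a) ∧ Differentiable ℝ f ∧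
      ∀ i, WHol δ a C m (pder i f)

namespace WHol

variable {δ a C : ℝ} {m : ℕ} {f : Euc d → V}

lemma bound (h : WHol δ a C m f) (x : Euc d) : ‖f x‖ ≤ C * r1 x ^ a := by
  cases m <;> exact h.1 x

lemma nonneg (h : WHol δ a C m f) : 0 ≤ C :=
  nonneg_of_mul_nonneg_left ((norm_nonneg _).trans (h.bound 0)) (r1_rpow_pos 0 a)

lemma mono {C' a' δ' : ℝ} (h : WHol δ a C m f) (hC : C ≤ C') (ha : a ≤ a') (hδ' : 0 < δ')
    (hδ : δ' ≤ δ) : WHol δ' a' C' m f := by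
  have hC0 := h.nonneg
  have hw (x : Euc d) : C * r1 x ^ a ≤ C' * r1 x ^ a' := by
    have := one_le_r1 x
    have := r1_rpow_pos x a
    have := hC0.trans hC
    gcongr
  induction m generalizing f with
  | zero =>
    refine ⟨fun x => (h.1 x).trans (hw x), fun x y hxy => (h.2 x y hxy).trans ?_⟩
    rcases eq_or_ne x y with rfl | hne
    · have := hδ'.trans_le hδ
      simp [Real.zero_rpow, this.ne', hδ'.ne']
    have hp : 0 < ‖x - y‖ := norm_pos_iff.2 (sub_ne_zero.2 hne)
    exact mul_le_mul (hw x) (Real.rpow_le_rpow_of_exponent_ge hp hxy hδ) (by positivity)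
      ((mul_nonneg hC0 (r1_rpow_pos x a).le).trans (hw x))
  | succ m ih => exact ⟨fun x => (h.1 x).trans (hw x), h.2.1, fun i => ih (h.2.2 i)⟩

lemma add {C' : ℝ} {g : Euc d → V} (hf : WHol δ a C m f) (hg : WHol δ a C' m g) :
    WHol δ a (C + C') m (fun x => f x + g x) := by
  have hb (x : Euc d) : ‖f x + g x‖ ≤ (C + C') * r1 x ^ a := by
    rw [add_mul]
    exact norm_add_le_of_le (hf.bound x) (hg.bound x)
  induction m generalizing f g with
  | zero =>
    refine ⟨hb, fun x y hxy => ?_⟩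
    rw [add_mul, add_mul, add_sub_add_comm]
    exact norm_add_le_of_le (hf.2 x y hxy) (hg.2 x y hxy)
  | succ m ih =>
    refine ⟨hb, hf.2.1.add hg.2.1, fun i => ?_⟩
    rw [pder_add hf.2.1 hg.2.1]
    exact ih (hf.2.2 i) (hg.2.2 i) (fun x => by
      rw [add_mul]
      exact norm_add_le_of_le ((hf.2.2 i).bound x) ((hg.2.2 i).bound x))

lemma clm (L : V →L[ℝ] V') (hf : WHol δ a C m f) :
    WHol δ a (‖L‖ * C) m (fun x => L (f x)) := by
  have hb {k : ℕ} {g : Euc d → V} (hg : WHol δ a C k g) (x : Euc d) :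
      ‖L (g x)‖ ≤ ‖L‖ * C * r1 x ^ a := by
    rw [mul_assoc]
    exact L.le_opNorm_of_le (hg.bound x)
  induction m generalizing f with
  | zero =>
    refine ⟨hb hf, fun x y hxy => ?_⟩
    rw [← map_sub, mul_assoc, mul_assoc, ← mul_assoc C]
    exact L.le_opNorm_of_le (hf.2 x y hxy)
  | succ m ih =>
    refine ⟨hb hf, L.differentiable.comp hf.2.1, fun i => ?_⟩
    rw [pder_comp_clm L hf.2.1]
    exact ih (hf.2.2 i)

lemma const {c : V} (hc : ‖c‖ ≤ C) (ha : 0 ≤ a) : WHol δ a C m (fun _ : Euc d => c) := by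
  have hC := (norm_nonneg c).trans hc
  have hb (x : Euc d) : C ≤ C * r1 x ^ a :=
    le_mul_of_one_le_right hC (Real.one_le_rpow (one_le_r1 x) ha)
  induction m generalizing c with
  | zero =>
    refine ⟨fun x => hc.trans (hb x), fun x y _ => ?_⟩
    have := r1_rpow_pos x a
    simpa using by positivity
  | succ m ih =>
    refine ⟨fun x => hc.trans (hb x), by fun_prop, fun i => ?_⟩
    have : pder i (fun _ : Euc d => c) = fun _ => 0 := by
      funext x
      simp [pder]
    rw [this]
    exact ih (by simpa using hC)

lemma sum {ι : Type*} (s : Finset ι) {F : ι → Euc d → V}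
    (ha : 0 ≤ a) (hf : ∀ j ∈ s, WHol δ a C m (F j)) :
    WHol δ a (s.card * C) m (fun x => ∑ j ∈ s, F j x) := by
  induction s using Finset.cons_induction with
  | empty => simpa using const (by simp) ha
  | cons j s hj ih =>
    simp only [Finset.sum_cons, Finset.card_cons, Nat.cast_add, Nat.cast_one]
    rw [add_mul, one_mul, add_comm _ C]
    exact (hf j (Finset.mem_cons_self j s)).add (ih fun k hk => hf k (Finset.mem_cons_of_mem hk))

end WHol

lemma norm_sub_le_of_pder_bound {R a C : ℝ} {f : Euc d → V} (ha : |a| ≤ R) (hC : 0 ≤ C)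
    (hd : Differentiable ℝ f) (hD : ∀ i x, ‖pder i f x‖ ≤ C * r1 x ^ a) {x y : Euc d}
    (hxy : ‖x - y‖ ≤ 1) : ‖f x - f y‖ ≤ d * 2 ^ R * C * r1 x ^ a * ‖x - y‖ := by
  refine (convex_segment x y).norm_image_sub_le_of_norm_fderiv_le (𝕜 := ℝ)
    (fun z _ => hd z) (fun z hz => ?_) (right_mem_segment ℝ x y) (left_mem_segment ℝ x y)
  have hz1 : ‖x - z‖ ≤ 1 := by
    rw [norm_sub_rev]
    exact (norm_sub_le_of_mem_segment hz).trans (by rwa [norm_sub_rev])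
  calc ‖fderiv ℝ f z‖ ≤ ∑ i : Fin d, ‖pder i f z‖ := norm_clm_le_sum _
    _ ≤ ∑ _i : Fin d, C * (2 ^ R * r1 x ^ a) := by
      refine Finset.sum_le_sum fun i _ => (hD i z).trans ?_
      gcongr
      exact r1_rpow_le hz1 ha
    _ = _ := by simp; ring

namespace WHol

variable {δ a C R : ℝ} {m : ℕ} {f : Euc d → V}

lemma zero_of_pder_bound (ha : |a| ≤ R) (hδ : δ ∈ Set.Ioc (0 : ℝ) 1)
    (hb : ∀ x, ‖f x‖ ≤ C * r1 x ^ a) (hd : Differentiable ℝ f)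
    (hD : ∀ i x, ‖pder i f x‖ ≤ C * r1 x ^ a) : WHol δ a ((1 + d * 2 ^ R) * C) 0 f := by
  have hC : 0 ≤ C := nonneg_of_mul_nonneg_left ((norm_nonneg _).trans (hb 0)) (r1_rpow_pos 0 a)
  refine ⟨fun x => (hb x).trans ?_, fun x y hxy => ?_⟩
  · have := r1_rpow_pos x a
    gcongr
    exact le_mul_of_one_le_left hC (le_add_of_nonneg_right (by positivity))
  · refine (norm_sub_le_of_pder_bound ha hC hd hD hxy).trans ?_
    have := r1_rpow_pos x a
    gcongr
    · linarith
    · exact Real.self_le_rpow_of_le_one (norm_nonneg _) hxy hδ.2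

lemma lower (ha : |a| ≤ R) (hδ : δ ∈ Set.Ioc (0 : ℝ) 1) (h : WHol δ a C (m + 1) f) :
    WHol δ a ((1 + d * 2 ^ R) * C) m f := by
  induction m generalizing f with
  | zero => exact zero_of_pder_bound ha hδ h.1 h.2.1 fun i => (h.2.2 i).bound
  | succ m ih =>
    refine ⟨fun x => (h.1 x).trans ?_, h.2.1, fun i => ih (h.2.2 i)⟩
    have := r1_rpow_pos x a
    gcongr
    exact le_mul_of_one_le_left h.nonneg (le_add_of_nonneg_right (by positivity))

lemma lower_add (ha : |a| ≤ R) (hδ : δ ∈ Set.Ioc (0 : ℝ) 1) {k : ℕ} (h : WHol δ a C (m + k) f) :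
    WHol δ a ((1 + d * 2 ^ R) ^ k * C) m f := by
  induction k generalizing C with
  | zero => simpa using h
  | succ k ih =>
    rw [pow_succ, mul_assoc]
    exact ih (lower ha hδ h)

lemma smul (d m : ℕ) (V : Type*) [NormedAddCommGroup V] [NormedSpace ℝ V] (R : ℝ) :
    ∃ K : ℝ, 0 ≤ K ∧ ∀ δ a b C C' : ℝ, ∀ (f : Euc d → ℝ) (g : Euc d → V),
      δ ∈ Set.Ioc (0 : ℝ) 1 → |a| ≤ R → |b| ≤ R → WHol δ a C m f → WHol δ b C' m g →
      WHol δ (a + b) (K * (C * C')) m (fun x => f x • g x) := by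
  have hb {δ a b C C' K : ℝ} {k : ℕ} {f : Euc d → ℝ} {g : Euc d → V} (hK : 1 ≤ K)
      (hf : WHol δ a C k f) (hg : WHol δ b C' k g) (x : Euc d) :
      ‖f x • g x‖ ≤ K * (C * C') * r1 x ^ (a + b) := by
    have hf0 := hf.nonneg
    have hg0 := hg.nonneg
    have ha := r1_rpow_pos x a
    have hb := r1_rpow_pos x b
    rw [norm_smul, Real.rpow_add (r1_pos x)]
    calc ‖f x‖ * ‖g x‖ ≤ (C * r1 x ^ a) * (C' * r1 x ^ b) :=
          mul_le_mul (hf.bound x) (hg.bound x) (norm_nonneg _) (by positivity)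
      _ ≤ K * ((C * r1 x ^ a) * (C' * r1 x ^ b)) := le_mul_of_one_le_left (by positivity) hK
      _ = _ := by ring
  suffices ∃ K : ℝ, 1 ≤ K ∧ ∀ δ a b C C' : ℝ, ∀ (f : Euc d → ℝ) (g : Euc d → V),
      δ ∈ Set.Ioc (0 : ℝ) 1 → |a| ≤ R → |b| ≤ R → WHol δ a C m f → WHol δ b C' m g →
      WHol δ (a + b) (K * (C * C')) m (fun x => f x • g x) by
    obtain ⟨K, hK, h⟩ := this
    exact ⟨K, by linarith, h⟩
  induction m with
  | zero =>
    refine ⟨1 + 2 ^ R, le_add_of_nonneg_right (by positivity), ?_⟩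
    intro δ a b C C' f g hδ ha hb' hf hg
    refine ⟨hb (le_add_of_nonneg_right (by positivity)) hf hg, fun x y hxy => ?_⟩
    have hf0 := hf.nonneg
    have hg0 := hg.nonneg
    have ha := r1_rpow_pos x a
    have hb := r1_rpow_pos x b
    have hfy : ‖f y‖ ≤ C * (2 ^ R * r1 x ^ a) :=
      (hf.bound y).trans (by gcongr; exact r1_rpow_le hxy ‹_›)
    calc ‖f x • g x - f y • g y‖ = ‖(f x - f y) • g x + f y • (g x - g y)‖ := by
          congr 1; module
      _ ≤ (C * r1 x ^ a * ‖x - y‖ ^ δ) * (C' * r1 x ^ b)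
          + (C * (2 ^ R * r1 x ^ a)) * (C' * r1 x ^ b * ‖x - y‖ ^ δ) := by
        refine norm_add_le_of_le ?_ ?_ <;> rw [norm_smul]
        · exact mul_le_mul (hf.2 x y hxy) (hg.bound x) (norm_nonneg _) (by positivity)
        · exact mul_le_mul hfy (hg.2 x y hxy) (norm_nonneg _) (by positivity)
      _ = _ := by rw [Real.rpow_add (r1_pos x)]; ring
  | succ m ih =>
    obtain ⟨K, hK, ih⟩ := ih
    set Q : ℝ := 1 + d * 2 ^ R with hQ
    have hQ1 : 1 ≤ Q := le_add_of_nonneg_right (by positivity)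
    have hKQ : 1 ≤ K * Q := one_le_mul_of_one_le_of_one_le hK hQ1
    refine ⟨2 * (K * Q), by linarith, ?_⟩
    intro δ a b C C' f g hδ ha hb' hf hg
    refine ⟨hb (by linarith) hf hg, hf.2.1.smul hg.2.1, fun i => ?_⟩
    rw [pder_smul hf.2.1 hg.2.1]
    convert (ih _ _ _ _ _ _ _ hδ ha hb' (hf.2.2 i) (lower hb' hδ hg)).add
      (ih _ _ _ _ _ _ _ hδ ha hb' (lower ha hδ hf) (hg.2.2 i)) using 1
    rw [← hQ]
    ring

lemma coord (hδ : δ ∈ Set.Ioc (0 : ℝ) 1) (i : Fin d) :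
    WHol δ 1 1 m (fun x : Euc d => x i) := by
  have hb (x : Euc d) : ‖x i‖ ≤ 1 * r1 x ^ (1 : ℝ) := by
    rw [one_mul, Real.rpow_one]
    exact (PiLp.norm_apply_le x i).trans (norm_le_r1 x)
  cases m with
  | zero =>
    refine ⟨hb, fun x y hxy => ?_⟩
    rw [one_mul, Real.rpow_one]
    calc ‖x i - y i‖ ≤ ‖x - y‖ := PiLp.norm_apply_le (x - y) i
      _ ≤ ‖x - y‖ ^ δ := Real.self_le_rpow_of_le_one (norm_nonneg _) hxy hδ.2
      _ ≤ _ := le_mul_of_one_le_left (by positivity) (one_le_r1 x)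
  | succ m =>
    refine ⟨hb, by fun_prop, fun j => ?_⟩
    have : pder j (fun x : Euc d => x i) =
        fun _ => (EuclideanSpace.single j (1 : ℝ) : Euc d) i := by
      funext x
      change fderiv ℝ (EuclideanSpace.proj (𝕜 := ℝ) i : Euc d →L[ℝ] ℝ) x _ = _
      rw [ContinuousLinearMap.fderiv]
      rfl
    rw [this]
    refine const ?_ zero_le_one
    exact (PiLp.norm_apply_le _ i).trans (by simp)

lemma r1_rpow (d m : ℕ) (R : ℝ) : ∃ K : ℝ, 0 ≤ K ∧ ∀ δ a : ℝ, δ ∈ Set.Ioc (0 : ℝ) 1 → |a| ≤ R →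
    WHol δ a K m (fun x : Euc d => r1 x ^ a) := by
  have habs {a : ℝ} (ha : |a| ≤ R) : |a - 2| ≤ R + 2 := (abs_sub _ _).trans (by simpa using ha)
  induction m generalizing R with
  | zero =>
    refine ⟨(1 + d * 2 ^ R) * (1 + |R|), by positivity, fun δ a hδ ha => ?_⟩
    have hR : |a| ≤ |R| := ha.trans (le_abs_self R)
    refine zero_of_pder_bound ha hδ (fun x => ?_)
      ((contDiff_r1_rpow a (n := 1)).differentiable one_ne_zero) fun i x => ?_
    · have := r1_rpow_pos x a
      rw [Real.norm_of_nonneg this.le]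
      exact le_mul_of_one_le_left this.le (by linarith [abs_nonneg R])
    · rw [pder_r1_rpow]
      have h1 := r1_rpow_pos x (a - 2)
      have h2 := (PiLp.norm_apply_le x i).trans (norm_le_r1 x)
      have h3 : r1 x * r1 x ^ (a - 2) ≤ r1 x ^ a := by
        rw [mul_comm, ← Real.rpow_add_one (r1_pos x).ne']
        exact Real.rpow_le_rpow_of_exponent_le (one_le_r1 x) (by linarith)
      rw [norm_smul, norm_smul, Real.norm_of_nonneg h1.le, Real.norm_eq_abs a]
      refine mul_le_mul (by linarith) ((mul_le_mul_of_nonneg_right h2 h1.le).trans h3)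
        (by positivity) (by positivity)
  | succ m ih =>
    obtain ⟨K, hK, ih⟩ := ih (R + 2) (fun ha => (abs_sub _ _).trans (by simpa using ha))
    obtain ⟨K', hK', hmul⟩ := smul d m ℝ (|R| + 2)
    refine ⟨1 + |R| * (K' * (1 * K)), by positivity, fun δ a hδ ha => ?_⟩
    have hR : |a| ≤ |R| := ha.trans (le_abs_self R)
    refine ⟨fun x => ?_, (contDiff_r1_rpow a (n := 1)).differentiable one_ne_zero, fun i => ?_⟩
    · have := r1_rpow_pos x a
      rw [Real.norm_of_nonneg this.le]
      exact le_mul_of_one_le_left this.le (le_add_of_nonneg_right (by positivity))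
    · rw [pder_r1_rpow]
      have h := hmul δ 1 (a - 2) 1 K _ _ hδ (by rw [abs_one]; linarith [abs_nonneg R])
        ((habs ha).trans (by linarith [le_abs_self R])) (coord hδ i) (ih δ (a - 2) hδ (habs ha))
      refine (h.clm (a • ContinuousLinearMap.id ℝ ℝ)).mono ?_ (by linarith) hδ.1 le_rfl
      have hn : ‖a • ContinuousLinearMap.id ℝ ℝ‖ ≤ |R| := by
        rw [norm_smul, ContinuousLinearMap.norm_id, mul_one]
        exact hR
      nlinarith [mul_le_mul_of_nonneg_right hn (show 0 ≤ K' * (1 * K) by positivity)]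

end WHol

end WeightedHolder

section SupNorm

variable {d : ℕ} {V : Type*} [NormedAddCommGroup V]

lemma norm_le_of_nrm0_le {f : Euc d → V} {C : ℝ} (hC : 0 ≤ C) (h : nrm0 f ≤ ENNReal.ofReal C)
    (x : Euc d) : ‖f x‖ ≤ C := by
  have h1 : (‖f x‖₊ : ℝ≥0∞) ≤ ENNReal.ofReal C := (le_iSup (fun x => (‖f x‖₊ : ℝ≥0∞)) x).trans h
  rwa [← enorm_eq_nnnorm, ← ofReal_norm, ENNReal.ofReal_le_ofReal_iff hC] at h1

lemma nrm0_le_ofReal {f : Euc d → V} {C : ℝ} (h : ∀ x, ‖f x‖ ≤ C) :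
    nrm0 f ≤ ENNReal.ofReal C := by
  refine iSup_le fun x => ?_
  rw [← enorm_eq_nnnorm, ← ofReal_norm]
  exact ENNReal.ofReal_le_ofReal (h x)

lemma norm_sub_le_of_hsemi_le {f : Euc d → V} {C δ : ℝ} (hC : 0 ≤ C)
    (h : hsemi δ f ≤ ENNReal.ofReal C) (x y : Euc d) : ‖f x - f y‖ ≤ C * ‖x - y‖ ^ δ := by
  rcases eq_or_ne x y with rfl | hne
  · simpa using by positivity
  have hp : 0 < ‖x - y‖ ^ δ := Real.rpow_pos_of_pos (norm_pos_iff.2 (sub_ne_zero.2 hne)) δ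
  have h1 : (‖f x - f y‖₊ : ℝ≥0∞) / ENNReal.ofReal (‖x - y‖ ^ δ) ≤ ENNReal.ofReal C := by
    refine le_trans ?_ h
    exact le_iSup_of_le x (le_iSup_of_le y (le_iSup_of_le hne le_rfl))
  rw [← enorm_eq_nnnorm, ← ofReal_norm, ← ENNReal.ofReal_div_of_pos hp,
    ENNReal.ofReal_le_ofReal_iff hC, div_le_iff₀ hp] at h1
  exact h1

lemma hsemi_le_ofReal {f : Euc d → V} {C δ : ℝ} (h : ∀ x y, ‖f x - f y‖ ≤ C * ‖x - y‖ ^ δ) :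
    hsemi δ f ≤ ENNReal.ofReal C := by
  refine iSup_le fun x => iSup_le fun y => iSup_le fun hne => ?_
  have hp : 0 < ‖x - y‖ ^ δ := Real.rpow_pos_of_pos (norm_pos_iff.2 (sub_ne_zero.2 hne)) δ
  rw [← enorm_eq_nnnorm, ← ofReal_norm, ← ENNReal.ofReal_div_of_pos hp]
  exact ENNReal.ofReal_le_ofReal ((div_le_iff₀ hp).2 (h x y))

end SupNorm

section HolderNorm

variable {d : ℕ} {V : Type*} [NormedAddCommGroup V] [NormedSpace ℝ V]

lemma ifl_add {m : ℕ} {δ : ℝ} (hδ : δ ∈ Set.Ioc (0 : ℝ) 1) : ifl (m + δ) = m := by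
  have : ⌈(m : ℝ) + δ⌉₊ = m + 1 := by
    rw [Nat.ceil_eq_iff (by omega)]
    constructor
    · simpa using hδ.1
    · simpa using hδ.2
  rw [ifl, this, Nat.add_sub_cancel]

lemma frc_add {m : ℕ} {δ : ℝ} (hδ : δ ∈ Set.Ioc (0 : ℝ) 1) : frc (m + δ) = δ := by
  rw [frc, ifl_add hδ, add_sub_cancel_left]

lemma nrm0_mder_le_holNorm {β : ℝ} {f : Euc d → V} (γ : Fin d → ℕ) (hγ : ∑ i, γ i ≤ ifl β) :
    nrm0 (mder γ f) ≤ holNorm β f :=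
  (ENNReal.le_tsum (f := fun γ : {γ : Fin d → ℕ // (∑ i, γ i) ≤ ifl β} => nrm0 (mder γ.1 f))
    ⟨γ, hγ⟩).trans le_self_add

lemma hsemi_mder_le_holNorm {β : ℝ} {f : Euc d → V} (γ : Fin d → ℕ) (hγ : ∑ i, γ i = ifl β) :
    hsemi (frc β) (mder γ f) ≤ holNorm β f :=
  (ENNReal.le_tsum
    (f := fun γ : {γ : Fin d → ℕ // (∑ i, γ i) = ifl β} => hsemi (frc β) (mder γ.1 f))
    ⟨γ, hγ⟩).trans le_add_self

lemma nrm0_le_holNorm {β : ℝ} (f : Euc d → V) : nrm0 f ≤ holNorm β f := by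
  simpa [mder_zero] using nrm0_mder_le_holNorm (β := β) (f := f) 0 (by simp)

namespace WHol

lemma of_holNorm_le {m : ℕ} {δ C : ℝ} {f : Euc d → V} (hδ : δ ∈ Set.Ioc (0 : ℝ) 1) (hC : 0 ≤ C)
    (hf : ContDiff ℝ (m : ℕ) f) (h : holNorm (m + δ) f ≤ ENNReal.ofReal C) :
    WHol δ 0 C m f := by
  have hsup (γ : Fin d → ℕ) (hγ : ∑ i, γ i ≤ m) (x : Euc d) :
      ‖mder γ f x‖ ≤ C * r1 x ^ (0 : ℝ) := by
    rw [Real.rpow_zero, mul_one]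
    exact norm_le_of_nrm0_le hC ((nrm0_mder_le_holNorm γ (by rwa [ifl_add hδ])).trans h) x
  suffices key : ∀ (k : ℕ) (γ : Fin d → ℕ), ∑ i, γ i + k = m → WHol δ 0 C k (mder γ f) by
    simpa [mder_zero] using key m 0 (by simp)
  intro k
  induction k with
  | zero =>
    intro γ hγ
    refine ⟨hsup γ (by omega), fun x y _ => ?_⟩
    rw [Real.rpow_zero, mul_one]
    refine norm_sub_le_of_hsemi_le hC (le_trans ?_ h) x y
    have := hsemi_mder_le_holNorm (β := m + δ) (f := f) γ (by rw [ifl_add hδ]; omega)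
    rwa [frc_add hδ] at this
  | succ k ih =>
    intro γ hγ
    refine ⟨hsup γ (by omega), ?_, fun i => ?_⟩
    · exact (contDiff_mder γ (m := 1) (hf.of_le (by norm_cast; omega))).differentiable (by simp)
    · rw [pder_mder γ i (hf.of_le (by norm_cast; omega))]
      refine ih _ ?_
      simp only [Pi.add_apply, Finset.sum_add_distrib, Finset.sum_pi_single',
        Finset.mem_univ, if_true]
      omega

lemma pderPow {δ a C : ℝ} (i : Fin d) (k : ℕ) {m : ℕ} {f : Euc d → V}
    (h : WHol δ a C (m + k) f) : WHol δ a C m (pderPow i k f) := by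
  induction k generalizing m with
  | zero => exact h
  | succ k ih => exact (ih (m := m + 1) (by rwa [add_assoc, add_comm 1 k])).2.2 i

lemma mder {δ a C : ℝ} (γ : Fin d → ℕ) {m : ℕ} {f : Euc d → V}
    (h : WHol δ a C (m + ∑ i, γ i) f) : WHol δ a C m (mder γ f) := by
  rw [← sum_map_finRange] at h
  unfold _root_.mder
  revert h
  generalize List.finRange d = l
  intro h
  induction l generalizing m with
  | nil => exact h
  | cons j l ih =>
    refine pderPow j (γ j) (ih ?_)
    simpa [add_assoc] using h

lemma holNorm_le (d m : ℕ) : ∃ K : ℝ, 0 ≤ K ∧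
    ∀ (V : Type) [NormedAddCommGroup V] [NormedSpace ℝ V] (δ C : ℝ) (f : Euc d → V),
      δ ∈ Set.Ioc (0 : ℝ) 1 → WHol δ 0 C m f → holNorm (m + δ) f ≤ ENNReal.ofReal (K * C) := by
  have hfin : {γ : Fin d → ℕ | ∑ i, γ i ≤ m}.Finite := by
    refine (Set.finite_Iic (fun _ : Fin d => m)).subset fun γ hγ i => ?_
    exact (Finset.single_le_sum (fun _ _ => Nat.zero_le _) (Finset.mem_univ i)).trans hγ
  have : Finite {γ : Fin d → ℕ // ∑ i, γ i ≤ m} := hfin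
  have : Finite {γ : Fin d → ℕ // ∑ i, γ i = m} := hfin.subset fun γ hγ => le_of_eq hγ
  have := Fintype.ofFinite {γ : Fin d → ℕ // ∑ i, γ i ≤ m}
  have := Fintype.ofFinite {γ : Fin d → ℕ // ∑ i, γ i = m}
  refine ⟨Fintype.card {γ : Fin d → ℕ // ∑ i, γ i ≤ m}
    + Fintype.card {γ : Fin d → ℕ // ∑ i, γ i = m} * 2, by positivity, ?_⟩
  intro V _ _ δ C f hδ h
  have hC := h.nonneg
  have hsup (γ : Fin d → ℕ) (hγ : ∑ i, γ i ≤ m) (x : Euc d) : ‖_root_.mder γ f x‖ ≤ C := by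
    obtain ⟨k, rfl⟩ := Nat.exists_eq_add_of_le' hγ
    simpa using (mder γ h).bound x
  have hsemi' (γ : Fin d → ℕ) (hγ : ∑ i, γ i = m) :
      hsemi δ (_root_.mder γ f) ≤ ENNReal.ofReal (2 * C) := by
    refine hsemi_le_ofReal fun x y => ?_
    have hp : 0 ≤ ‖x - y‖ ^ δ := by positivity
    rcases le_total ‖x - y‖ 1 with hxy | hxy
    · have h0 : WHol δ 0 C 0 (_root_.mder γ f) := mder γ (by rwa [zero_add, hγ])
      have := h0.2 x y hxy
      rw [Real.rpow_zero, mul_one] at this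
      nlinarith [mul_nonneg hC hp]
    · have h1 : 1 ≤ ‖x - y‖ ^ δ := Real.one_le_rpow hxy hδ.1.le
      refine (norm_sub_le _ _).trans ?_
      nlinarith [hsup γ hγ.le x, hsup γ hγ.le y]
  unfold holNorm
  rw [ifl_add hδ, frc_add hδ, tsum_fintype, tsum_fintype, add_mul,
    ENNReal.ofReal_add (by positivity) (by positivity), mul_assoc]
  refine add_le_add ?_ ?_
  · refine (Finset.sum_le_sum fun γ _ => nrm0_le_ofReal (hsup γ.1 γ.2)).trans ?_
    simp [ENNReal.ofReal_mul]
  · refine (Finset.sum_le_sum fun γ _ => hsemi' γ.1 γ.2).trans ?_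
    simp [ENNReal.ofReal_mul]

end WHol

end HolderNorm

section Composition

variable {d : ℕ}

lemma r1_le_of_norm_le {θ M : ℝ} (hθ : 0 ≤ θ) (hM : 0 ≤ M) {x u : Euc d}
    (h : ‖u‖ ≤ M * r1 x ^ θ) : r1 u ≤ (1 + M) * r1 x ^ θ := by
  have h1 : 1 ≤ r1 x ^ θ := Real.one_le_rpow (one_le_r1 x) hθ
  refine le_of_sq_le_sq ?_ (by positivity)
  rw [r1_sq]
  nlinarith [pow_le_pow_left₀ (norm_nonneg u) h 2, mul_nonneg hM (sq_nonneg (r1 x ^ θ))]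

lemma r1_rpow_le_of_norm_le {θ M θ₁ : ℝ} (hθ : 0 ≤ θ) (hM : 0 ≤ M) (hθ₁ : 0 ≤ θ₁) {x u : Euc d}
    (h : ‖u‖ ≤ M * r1 x ^ θ) : r1 u ^ θ₁ ≤ (1 + M) ^ θ₁ * r1 x ^ (θ₁ * θ) := by
  rw [mul_comm θ₁, Real.rpow_mul (r1_pos x).le,
    ← Real.mul_rpow (by positivity) (r1_rpow_pos x θ).le]
  exact Real.rpow_le_rpow (r1_pos u).le (r1_le_of_norm_le hθ hM h) hθ₁

lemma norm_comp_le {θ₁ θ₃ A M : ℝ} (hθ₁ : 0 ≤ θ₁) (hθ₃ : 0 ≤ θ₃) (hA : 0 ≤ A) (hM : 0 ≤ M)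
    {φ : Euc d → ℝ} {H : Euc d → Euc d} (hφ : ∀ x, ‖φ x‖ ≤ A * r1 x ^ θ₁)
    (hH : ∀ x, ‖H x‖ ≤ M * r1 x ^ θ₃) (x : Euc d) :
    ‖φ (H x)‖ ≤ A * (1 + M) ^ θ₁ * r1 x ^ (θ₁ * θ₃) := by
  refine (hφ (H x)).trans ?_
  rw [mul_assoc]
  gcongr
  exact r1_rpow_le_of_norm_le hθ₃ hM hθ₁ (hH x)

lemma WHol.comp_zero {θ₁ θ₃ θ₄ δ A M : ℝ} (hθ₁ : 0 ≤ θ₁) (hθ₃ : 0 ≤ θ₃) (hθ₄ : 0 ≤ θ₄)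
    (hδ : δ ∈ Set.Ioc (0 : ℝ) 1) (hM : 0 ≤ M)
    {φ : Euc d → ℝ} {H : Euc d → Euc d} (hφ : WHol δ θ₁ A 0 φ) (hHd : Differentiable ℝ H)
    (hH : ∀ x, ‖H x‖ ≤ M * r1 x ^ θ₃) (hDH : ∀ i x, ‖pder i H x‖ ≤ M * r1 x ^ θ₄) :
    WHol δ (θ₁ * θ₃ + θ₄ * δ)
      ((1 + 2 ^ (θ₁ * θ₃)) * (1 + d * 2 ^ θ₄) * (A * (1 + M) ^ (θ₁ + δ))) 0
      (fun x => φ (H x)) := by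
  have hA := hφ.nonneg
  set P : ℝ := 1 + 2 ^ (θ₁ * θ₃) with hP
  set Q : ℝ := 1 + d * 2 ^ θ₄ with hQ
  have hP1 : 1 ≤ P := le_add_of_nonneg_right (by positivity)
  have hQ1 : 1 ≤ Q := le_add_of_nonneg_right (by positivity)
  have hb := norm_comp_le hθ₁ hθ₃ hA hM hφ.bound hH
  refine ⟨fun x => (hb x).trans ?_, fun x y hxy => ?_⟩
  · have h1 : (1 + M) ^ θ₁ ≤ (1 + M) ^ (θ₁ + δ) :=
      Real.rpow_le_rpow_of_exponent_le (by linarith) (by linarith [hδ.1])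
    have h2 : r1 x ^ (θ₁ * θ₃) ≤ r1 x ^ (θ₁ * θ₃ + θ₄ * δ) :=
      Real.rpow_le_rpow_of_exponent_le (one_le_r1 x) (by nlinarith [hδ.1])
    have h3 := r1_rpow_pos x (θ₁ * θ₃)
    calc A * (1 + M) ^ θ₁ * r1 x ^ (θ₁ * θ₃)
        ≤ A * (1 + M) ^ (θ₁ + δ) * r1 x ^ (θ₁ * θ₃ + θ₄ * δ) := by gcongr
      _ ≤ _ := by
        refine mul_le_mul_of_nonneg_right ?_ (r1_rpow_pos x _).le
        exact le_mul_of_one_le_left (by positivity) (one_le_mul_of_one_le_of_one_le hP1 hQ1)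
  · have hrx := r1_rpow_pos x (θ₁ * θ₃)
    have hrx4 := r1_rpow_pos x θ₄
    set S : ℝ := A * (1 + M) ^ θ₁ * r1 x ^ (θ₁ * θ₃) with hS
    have hS0 : 0 ≤ S := by positivity
    have hstep : ‖φ (H x) - φ (H y)‖ ≤ P * S * ‖H x - H y‖ ^ δ := by
      rcases le_total ‖H x - H y‖ 1 with hc | hc
      · refine (hφ.2 _ _ hc).trans ?_
        refine mul_le_mul_of_nonneg_right ?_ (by positivity)
        refine le_trans ?_ (le_mul_of_one_le_left hS0 hP1)
        rw [hS, mul_assoc]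
        gcongr
        exact r1_rpow_le_of_norm_le hθ₃ hM hθ₁ (hH x)
      · have h1 : 1 ≤ ‖H x - H y‖ ^ δ := Real.one_le_rpow hc hδ.1.le
        refine le_trans ?_ (le_mul_of_one_le_right (by positivity) h1)
        have hy : ‖φ (H y)‖ ≤ 2 ^ (θ₁ * θ₃) * S := by
          refine (hb y).trans ?_
          have := r1_rpow_le (R := θ₁ * θ₃) hxy (abs_of_nonneg (mul_nonneg hθ₁ hθ₃)).le
          calc _ ≤ A * (1 + M) ^ θ₁ * (2 ^ (θ₁ * θ₃) * r1 x ^ (θ₁ * θ₃)) := by gcongr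
            _ = _ := by rw [hS]; ring
        refine (norm_sub_le_of_le (hb x) hy).trans (le_of_eq ?_)
        rw [hP]
        ring
    have hHxy : ‖H x - H y‖ ≤ Q * (1 + M) * r1 x ^ θ₄ * ‖x - y‖ := by
      refine (norm_sub_le_of_pder_bound (abs_of_nonneg hθ₄).le hM hHd hDH hxy).trans ?_
      gcongr
      · rw [hQ]; linarith
      · linarith
    have hpow : ‖H x - H y‖ ^ δ ≤ Q * (1 + M) ^ δ * r1 x ^ (θ₄ * δ) * ‖x - y‖ ^ δ := by
      refine (Real.rpow_le_rpow (norm_nonneg _) hHxy hδ.1.le).trans ?_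
      rw [Real.mul_rpow (by positivity) (norm_nonneg _), Real.mul_rpow (by positivity) hrx4.le,
        Real.mul_rpow (by positivity) (by positivity), ← Real.rpow_mul (r1_pos x).le]
      have := r1_rpow_pos x (θ₄ * δ)
      gcongr
      exact Real.rpow_le_self_of_one_le hQ1 hδ.2
    calc _ ≤ P * S * (Q * (1 + M) ^ δ * r1 x ^ (θ₄ * δ) * ‖x - y‖ ^ δ) := by
          refine hstep.trans ?_
          gcongr
      _ = _ := by
          rw [hS, Real.rpow_add (by linarith), Real.rpow_add (r1_pos x)]
          ring

/-- Weighted Hölder bound for a composition. -/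
lemma WHol.comp (d m : ℕ) {θ₁ θ₃ θ₄ : ℝ} (hθ₁ : 0 ≤ θ₁) (hθ₃ : 0 ≤ θ₃) (hθ₄ : 0 ≤ θ₄) :
    ∃ K : ℝ, 1 ≤ K ∧ ∀ (δ A M : ℝ) (φ : Euc d → ℝ) (H : Euc d → Euc d),
      δ ∈ Set.Ioc (0 : ℝ) 1 → 0 ≤ M → WHol δ θ₁ A m φ → Differentiable ℝ H →
      (∀ x, ‖H x‖ ≤ M * r1 x ^ θ₃) → (∀ i x, ‖pder i H x‖ ≤ M * r1 x ^ θ₄) →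
      (∀ k < m, ∀ i j, WHol δ θ₄ M k (fun x => pder i H x j)) →
      WHol δ (θ₁ * θ₃ + θ₄ * (m + δ)) (K * (A * (1 + M) ^ (θ₁ + m + δ))) m
        (fun x => φ (H x)) := by
  induction m with
  | zero =>
    refine ⟨(1 + 2 ^ (θ₁ * θ₃)) * (1 + d * 2 ^ θ₄), ?_, ?_⟩
    · exact one_le_mul_of_one_le_of_one_le (le_add_of_nonneg_right (by positivity))
        (le_add_of_nonneg_right (by positivity))
    · intro δ A M φ H hδ hM hφ hHd hH hDH _
      simpa using comp_zero hθ₁ hθ₃ hθ₄ hδ hM hφ hHd hH hDH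
  | succ m ih =>
    obtain ⟨K, hK, ih⟩ := ih
    obtain ⟨K', hK', hmul⟩ := WHol.smul d m ℝ (θ₁ * θ₃ + θ₄ * (m + 1) + θ₄)
    refine ⟨1 + d * (K' * K), le_add_of_nonneg_right (by positivity), ?_⟩
    intro δ A M φ H hδ hM hφ hHd hH hDH hW
    have hA := hφ.nonneg
    have hδ0 := hδ.1
    set T : ℝ := A * (1 + M) ^ (θ₁ + (m + 1 : ℕ) + δ) with hT
    have hT0 : 0 ≤ T := by positivity
    have hexp : 0 ≤ θ₁ * θ₃ + θ₄ * ((m + 1 : ℕ) + δ) := by positivity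
    refine ⟨fun x => ?_, hφ.2.1.comp hHd, fun i => ?_⟩
    · refine (norm_comp_le hθ₁ hθ₃ hA hM hφ.bound hH x).trans ?_
      have h1 : (1 + M) ^ θ₁ ≤ (1 + M) ^ (θ₁ + (m + 1 : ℕ) + δ) :=
        Real.rpow_le_rpow_of_exponent_le (by linarith) (by push_cast; linarith)
      have h2 : r1 x ^ (θ₁ * θ₃) ≤ r1 x ^ (θ₁ * θ₃ + θ₄ * ((m + 1 : ℕ) + δ)) :=
        Real.rpow_le_rpow_of_exponent_le (one_le_r1 x) (le_add_of_nonneg_right (by positivity))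
      have h3 := r1_rpow_pos x (θ₁ * θ₃)
      calc A * (1 + M) ^ θ₁ * r1 x ^ (θ₁ * θ₃)
          ≤ T * r1 x ^ (θ₁ * θ₃ + θ₄ * ((m + 1 : ℕ) + δ)) := by rw [hT]; gcongr
        _ ≤ _ := by
          refine mul_le_mul_of_nonneg_right ?_ (r1_rpow_pos x _).le
          exact le_mul_of_one_le_left hT0 (le_add_of_nonneg_right (by positivity))
    · rw [pder_comp hφ.2.1 hHd]
      have hterm (j : Fin d) : WHol δ (θ₁ * θ₃ + θ₄ * ((m + 1 : ℕ) + δ)) (K' * K * T) m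
          (fun x => pder i H x j • pder j φ (H x)) := by
        have h1 := ih δ A M (pder j φ) H hδ hM (hφ.2.2 j) hHd hH hDH
          fun k hk => hW k (by omega)
        have h2 := hmul δ θ₄ _ M _ _ _ hδ
          (by rw [abs_of_nonneg hθ₄]; exact le_add_of_nonneg_left (by positivity))
          (by
            rw [abs_of_nonneg (by positivity)]
            nlinarith [mul_le_mul_of_nonneg_left hδ.2 hθ₄]) (hW m (by omega) i j) h1
        refine h2.mono ?_ (by push_cast; linarith) hδ.1 le_rfl
        have h3 : M * (1 + M) ^ (θ₁ + m + δ) ≤ (1 + M) ^ (θ₁ + (m + 1 : ℕ) + δ) := by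
          rw [show θ₁ + ((m + 1 : ℕ) : ℝ) + δ = 1 + (θ₁ + m + δ) by push_cast; ring,
            Real.rpow_add (by linarith) 1, Real.rpow_one]
          gcongr
          linarith
        calc _ = K' * K * (A * (M * (1 + M) ^ (θ₁ + m + δ))) := by ring
          _ ≤ _ := by rw [hT]; gcongr
      have hs := WHol.sum Finset.univ hexp (fun j _ => hterm j)
      refine hs.mono ?_ le_rfl hδ.1 le_rfl
      rw [Finset.card_univ, Fintype.card_fin]
      linarith

end Composition

section WeightedNorms

variable {d : ℕ} {V : Type*} [NormedAddCommGroup V] [NormedSpace ℝ V]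

lemma norm_r1_rpow_neg_smul_le_iff {a C : ℝ} {x : Euc d} {v : V} :
    ‖r1 x ^ (-a) • v‖ ≤ C ↔ ‖v‖ ≤ C * r1 x ^ a := by
  rw [norm_smul, Real.norm_of_nonneg (r1_rpow_pos x _).le, Real.rpow_neg (r1_pos x).le,
    ← div_eq_inv_mul, div_le_iff₀ (r1_rpow_pos x a)]

lemma WHol.of_holNorm_weighted_le (d m : ℕ) (V : Type*) [NormedAddCommGroup V] [NormedSpace ℝ V]
    (a : ℝ) : ∃ K : ℝ, 0 ≤ K ∧ ∀ (δ C : ℝ) (f : Euc d → V), δ ∈ Set.Ioc (0 : ℝ) 1 → 0 ≤ C →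
      ContDiff ℝ (m : ℕ) f → holNorm (m + δ) (fun x => r1 x ^ (-a) • f x) ≤ ENNReal.ofReal C →
      WHol δ a (K * C) m f := by
  obtain ⟨K, hK, hr⟩ := WHol.r1_rpow d m |a|
  obtain ⟨K', hK', hmul⟩ := WHol.smul d m V |a|
  refine ⟨K' * K, by positivity, fun δ C f hδ hC hf h => ?_⟩
  have h1 := WHol.of_holNorm_le hδ hC ((contDiff_r1_rpow (-a)).smul hf) h
  have h2 := hmul δ a 0 K C _ _ hδ le_rfl (by simp) (hr δ a hδ le_rfl) h1
  rw [add_zero, ← mul_assoc] at h2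
  convert h2 using 2 with x
  rw [Pi.smul_apply', smul_smul, ← Real.rpow_add (r1_pos x), add_neg_cancel, Real.rpow_zero, one_smul]

lemma WHol.fderiv {m : ℕ} {δ a C : ℝ} {f : Euc d → ℝ} (ha : 0 ≤ a) (hδ : 0 < δ)
    (h : WHol δ a C (m + 1) f) : WHol δ a (d * C) m (fderiv ℝ f) := by
  have hC := h.nonneg
  have hL (i : Fin d) : WHol δ a C m
      (fun x => ContinuousLinearMap.toSpanSingleton ℝ (EuclideanSpace.proj i : Euc d →L[ℝ] ℝ)
        (pder i f x)) := by
    refine ((h.2.2 i).clm _).mono (mul_le_of_le_one_left hC ?_) le_rfl hδ le_rfl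
    rw [ContinuousLinearMap.norm_toSpanSingleton]
    exact ContinuousLinearMap.opNorm_le_bound _ zero_le_one fun v => by
      simpa using PiLp.norm_apply_le v i
  convert WHol.sum Finset.univ ha (fun i _ => hL i) using 1
  · simp
  · funext x
    ext v
    conv_lhs => rw [eq_sum_single v]
    simp [pder, mul_comm]

lemma WHol.holNorm_weighted_fderiv_le (d m : ℕ) (R : ℝ) : ∃ K : ℝ, 0 ≤ K ∧
    ∀ (δ a C : ℝ) (f : Euc d → ℝ), δ ∈ Set.Ioc (0 : ℝ) 1 → 0 ≤ a → a ≤ R →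
      WHol δ a C (m + 1) f →
      holNorm (m + δ) (fun x => r1 x ^ (-a) • _root_.fderiv ℝ f x) ≤ ENNReal.ofReal (K * C) := by
  obtain ⟨K, hK, hr⟩ := WHol.r1_rpow d m R
  obtain ⟨K', hK', hmul⟩ := WHol.smul d m (Euc d →L[ℝ] ℝ) R
  obtain ⟨K'', hK'', hnorm⟩ := WHol.holNorm_le d m
  refine ⟨K'' * (K' * (K * d)), by positivity, fun δ a C f hδ ha haR h => ?_⟩
  have haR' : |a| ≤ R := by rwa [abs_of_nonneg ha]
  have hneg : |-a| ≤ R := by rwa [abs_neg]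
  have h1 := hmul δ (-a) a K _ _ _ hδ hneg haR' (hr δ (-a) hδ hneg) (h.fderiv ha hδ.1)
  rw [neg_add_cancel] at h1
  refine (hnorm _ δ _ _ hδ h1).trans (le_of_eq ?_)
  ring_nf

lemma nrm0_weighted_comp_le {θ₁ θ₃ : ℝ} (hθ₁ : 0 ≤ θ₁) (hθ₃ : 0 ≤ θ₃) {φ : Euc d → ℝ}
    {H : Euc d → Euc d} (hφ : nrm0 (fun x => r1 x ^ (-θ₁) * φ x) ≠ ⊤)
    (hH : nrm0 (fun x => r1 x ^ (-θ₃) • H x) ≠ ⊤) :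
    nrm0 (fun x => r1 x ^ (-(θ₁ * θ₃)) * φ (H x)) ≤
      nrm0 (fun x => r1 x ^ (-θ₁) * φ x) * (1 + nrm0 (fun x => r1 x ^ (-θ₃) • H x)) ^ θ₁ := by
  obtain ⟨A, hA⟩ : ∃ A : NNReal, (A : ℝ≥0∞) = _ := ⟨_, ENNReal.coe_toNNReal hφ⟩
  obtain ⟨M, hM⟩ : ∃ M : NNReal, (M : ℝ≥0∞) = _ := ⟨_, ENNReal.coe_toNNReal hH⟩
  have hφ' (x : Euc d) : ‖φ x‖ ≤ A * r1 x ^ θ₁ := norm_r1_rpow_neg_smul_le_iff.1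
    (norm_le_of_nrm0_le A.coe_nonneg (f := fun x => r1 x ^ (-θ₁) * φ x) (by rw [← hA]; simp) x)
  have hH' (x : Euc d) : ‖H x‖ ≤ M * r1 x ^ θ₃ := norm_r1_rpow_neg_smul_le_iff.1
    (norm_le_of_nrm0_le M.coe_nonneg (f := fun x => r1 x ^ (-θ₃) • H x) (by rw [← hM]; simp) x)
  rw [← hA, ← hM]
  refine (nrm0_le_ofReal (C := A * (1 + M) ^ θ₁) fun x => ?_).trans (le_of_eq ?_)
  · exact norm_r1_rpow_neg_smul_le_iff.2 (norm_comp_le hθ₁ hθ₃ A.coe_nonneg M.coe_nonneg hφ' hH' x)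
  · rw [ENNReal.ofReal_mul A.coe_nonneg, ← ENNReal.ofReal_rpow_of_pos (by positivity),
      ENNReal.ofReal_add zero_le_one M.coe_nonneg]
    simp

/-- The weighted Hölder estimate for `∇(φ ∘ H)` in terms of real upper bounds. -/
lemma exists_holNorm_weighted_fderiv_comp_le (d m : ℕ) {θ₁ θ₃ θ₄ : ℝ} (hθ₁ : 0 ≤ θ₁)
    (hθ₃ : 0 ≤ θ₃) (hθ₄ : 0 ≤ θ₄) : ∃ N : ℝ, 0 < N ∧
    ∀ (β μ A M : ℝ) (φ : Euc d → ℝ) (H : Euc d → Euc d), β ∈ Set.Ioc (0 : ℝ) 1 →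
      μ ∈ Set.Ioc (0 : ℝ) 1 → 0 ≤ A → 0 ≤ M →
      ContDiff ℝ (m + 1 : ℕ) φ → ContDiff ℝ (m + 1 : ℕ) H →
      holNorm ((m + 1 : ℕ) + β) (fun x => r1 x ^ (-θ₁) * φ x) ≤ ENNReal.ofReal A →
      nrm0 (fun x => r1 x ^ (-θ₃) • H x) ≤ ENNReal.ofReal M →
      holNorm (m + μ) (fun x => r1 x ^ (-θ₄) • fderiv ℝ H x) ≤ ENNReal.ofReal M →
      holNorm (m + min μ β) (fun x => r1 x ^ (-(θ₁ * θ₃ + θ₄ * ((m + 1 : ℕ) + min μ β)))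
          • fderiv ℝ (fun y => φ (H y)) x) ≤
        ENNReal.ofReal (N * A * (1 + M) ^ (θ₁ + (m + 1 : ℕ) + min μ β)) := by
  obtain ⟨K₁, hK₁, hweightφ⟩ := WHol.of_holNorm_weighted_le d (m + 1) ℝ θ₁
  obtain ⟨K₂, hK₂, hweightH⟩ := WHol.of_holNorm_weighted_le d m (Euc d →L[ℝ] Euc d) θ₄
  obtain ⟨K₃, hK₃, hcomp⟩ := WHol.comp d (m + 1) hθ₁ hθ₃ hθ₄
  obtain ⟨K₄, hK₄, hout⟩ :=
    WHol.holNorm_weighted_fderiv_le d m (θ₁ * θ₃ + θ₄ * ((m + 1 : ℕ) + 1))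
  set Q : ℝ := 1 + d * 2 ^ θ₄ with hQ
  have hQ1 : 1 ≤ Q := le_add_of_nonneg_right (by positivity)
  have hQm : 1 ≤ Q ^ m := one_le_pow₀ hQ1
  set c : ℝ := 1 + Q ^ m * K₂ with hc
  have hc1 : 1 ≤ c := le_add_of_nonneg_right (by positivity)
  refine ⟨1 + K₄ * K₃ * K₁ * c ^ (θ₁ + (m + 1 : ℕ) + 1), by positivity, ?_⟩
  intro β μ A M φ H hβ hμ hA hM hφ hH hφn hHn hDHn
  set δ := min μ β with hδdef
  have hδ : δ ∈ Set.Ioc (0 : ℝ) 1 := ⟨lt_min hμ.1 hβ.1, (min_le_left _ _).trans hμ.2⟩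
  have hδ0 := hδ.1
  have hWφ : WHol δ θ₁ (K₁ * A) (m + 1) φ :=
    (hweightφ β A φ hβ hA hφ hφn).mono le_rfl le_rfl hδ.1 (min_le_right _ _)
  have hWDH : WHol δ θ₄ (K₂ * M) m (fderiv ℝ H) :=
    (hweightH μ M _ hμ hM (hH.fderiv_right (by norm_cast)) hDHn).mono le_rfl le_rfl hδ.1
      (min_le_left _ _)
  have hKc : K₂ ≤ c := by nlinarith
  have hb (x : Euc d) : ‖H x‖ ≤ c * M * r1 x ^ θ₃ := by
    refine (norm_r1_rpow_neg_smul_le_iff.1 (norm_le_of_nrm0_le hM hHn x)).trans ?_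
    have := r1_rpow_pos x θ₃
    gcongr
    exact le_mul_of_one_le_left hM hc1
  have hDb (i : Fin d) (x : Euc d) : ‖pder i H x‖ ≤ c * M * r1 x ^ θ₄ := by
    have h1 : ‖pder i H x‖ ≤ ‖fderiv ℝ H x‖ := by
      simpa [pder] using (fderiv ℝ H x).le_opNorm (EuclideanSpace.single i (1 : ℝ))
    refine (h1.trans (hWDH.bound x)).trans ?_
    have := r1_rpow_pos x θ₄
    gcongr
  have hW (k : ℕ) (hk : k < m + 1) (i j : Fin d) :
      WHol δ θ₄ (c * M) k (fun x => pder i H x j) := by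
    obtain ⟨l, rfl⟩ := Nat.exists_eq_add_of_le (Nat.lt_succ_iff.1 hk)
    have h1 := WHol.lower_add (abs_of_nonneg hθ₄).le hδ hWDH
    have h2 := h1.clm ((EuclideanSpace.proj j : Euc d →L[ℝ] ℝ).comp
      (ContinuousLinearMap.apply ℝ (Euc d) (EuclideanSpace.single i (1 : ℝ) : Euc d)))
    refine h2.mono ?_ le_rfl hδ.1 le_rfl
    refine (mul_le_of_le_one_left h1.nonneg ?_).trans ?_
    · refine ContinuousLinearMap.opNorm_le_bound _ zero_le_one fun T => ?_
      refine (PiLp.norm_apply_le _ j).trans ?_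
      simpa using T.le_opNorm (EuclideanSpace.single i (1 : ℝ))
    · rw [← hQ, ← mul_assoc]
      gcongr
      have : Q ^ l ≤ Q ^ (k + l) := pow_le_pow_right₀ hQ1 (by omega)
      nlinarith
  have hWcomp := hcomp δ (K₁ * A) (c * M) φ H hδ (by positivity) hWφ
    (hH.differentiable (by simp)) hb hDb hW
  refine (hout δ _ _ _ hδ (by positivity) (by gcongr; exact hδ.2) hWcomp).trans ?_
  refine ENNReal.ofReal_le_ofReal ?_
  have hpow : (1 + c * M) ^ (θ₁ + (m + 1 : ℕ) + δ) ≤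
      c ^ (θ₁ + (m + 1 : ℕ) + 1) * (1 + M) ^ (θ₁ + (m + 1 : ℕ) + δ) := by
    calc (1 + c * M) ^ (θ₁ + (m + 1 : ℕ) + δ) ≤ (c * (1 + M)) ^ (θ₁ + (m + 1 : ℕ) + δ) := by
          gcongr
          linarith
      _ = c ^ (θ₁ + (m + 1 : ℕ) + δ) * (1 + M) ^ (θ₁ + (m + 1 : ℕ) + δ) :=
          Real.mul_rpow (by positivity) (by positivity)
      _ ≤ _ := by
          gcongr
          exact hδ.2
  calc _ = K₄ * K₃ * K₁ * A * (1 + c * M) ^ (θ₁ + (m + 1 : ℕ) + δ) := by ring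
    _ ≤ K₄ * K₃ * K₁ * A *
        (c ^ (θ₁ + (m + 1 : ℕ) + 1) * (1 + M) ^ (θ₁ + (m + 1 : ℕ) + δ)) := by gcongr
    _ ≤ _ := by
        have : 0 ≤ A * (1 + M) ^ (θ₁ + (m + 1 : ℕ) + δ) := by positivity
        linarith

end WeightedNorms

/-- weighted Hölder estimate for the composition `φ ∘ H`. -/
theorem stmt_8 (d : ℕ) (hd : 1 ≤ d) (n : ℕ) (hn : 1 ≤ n) (θ₁ θ₃ θ₄ β : ℝ)
    (hθ₁ : 0 ≤ θ₁) (hθ₃ : 0 ≤ θ₃) (hθ₄ : 0 ≤ θ₄) (h34 : θ₃ - θ₄ ≤ 1)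
    (hβ : β ∈ Set.Ioc (0 : ℝ) 1) :
    ∃ N : ℝ, 0 < N ∧
      ∀ μ : ℝ, μ ∈ Set.Ioc (0 : ℝ) 1 →
        ∀ (φ : Euc d → ℝ) (H : Euc d → Euc d),
          ContDiff ℝ (n : ℕ) φ → ContDiff ℝ (n : ℕ) H →
          holNorm ((n : ℝ) + β) (fun x => r1 x ^ (-θ₁) * φ x) ≠ ⊤ →
          nrm0 (fun x => r1 x ^ (-θ₃) • H x)
            + holNorm ((n : ℝ) - 1 + μ) (fun x => r1 x ^ (-θ₄) • fderiv ℝ H x) ≠ ⊤ →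
          (nrm0 (fun x => r1 x ^ (-(θ₁ * θ₃)) * φ (H x)) ≤
              nrm0 (fun x => r1 x ^ (-θ₁) * φ x)
                * (1 + nrm0 (fun x => r1 x ^ (-θ₃) • H x)) ^ θ₁)
          ∧ holNorm ((n : ℝ) - 1 + min μ β)
                (fun x => r1 x ^ (-(θ₁ * θ₃ + θ₄ * ((n : ℝ) + min μ β)))
                  • fderiv ℝ (fun y => φ (H y)) x) ≤
              ENNReal.ofReal N * holNorm ((n : ℝ) + β) (fun x => r1 x ^ (-θ₁) * φ x)
                * (1 + (nrm0 (fun x => r1 x ^ (-θ₃) • H x)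
                    + holNorm ((n : ℝ) - 1 + μ)
                        (fun x => r1 x ^ (-θ₄) • fderiv ℝ H x))) ^ (θ₁ + min μ β + n) := by
  obtain ⟨m, rfl⟩ := Nat.exists_eq_add_of_le' hn
  obtain ⟨N, hN, key⟩ := exists_holNorm_weighted_fderiv_comp_le d m hθ₁ hθ₃ hθ₄
  refine ⟨N, hN, fun μ hμ φ H hφ hH hφn hHn => ⟨?_, ?_⟩⟩
  · exact nrm0_weighted_comp_le hθ₁ hθ₃ (ne_top_of_le_ne_top hφn (nrm0_le_holNorm _))
      (ne_top_of_le_ne_top hHn le_self_add)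
  · have hm (t : ℝ) : ((m + 1 : ℕ) : ℝ) - 1 + t = m + t := by push_cast; ring
    simp only [hm] at hHn ⊢
    obtain ⟨A, hA⟩ : ∃ A : NNReal, (A : ℝ≥0∞) = _ := ⟨_, ENNReal.coe_toNNReal hφn⟩
    obtain ⟨M, hM⟩ : ∃ M : NNReal, (M : ℝ≥0∞) = _ := ⟨_, ENNReal.coe_toNNReal hHn⟩
    rw [← hA, ← hM]
    refine (key β μ A M φ H hβ hμ A.coe_nonneg M.coe_nonneg hφ hH (by simp only [← hA, ENNReal.ofReal_coe_nnreal, le_refl])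
      (by rw [ENNReal.ofReal_coe_nnreal, hM]; exact le_self_add)
      (by rw [ENNReal.ofReal_coe_nnreal, hM]; exact le_add_self)).trans (le_of_eq ?_)
    rw [ENNReal.ofReal_mul (by positivity), ENNReal.ofReal_mul hN.le,
      ← ENNReal.ofReal_rpow_of_pos (by positivity), ENNReal.ofReal_add zero_le_one M.coe_nonneg,
      add_right_comm]
    simp
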